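/- arXiv:2203.10864 — 2 statements merged into one kernel-verified Lean document; each statement's English description precedes it below -/
import Mathlib

section
/- Let (k,X,Ω,A,K) be an instance of weight-constrained anisotropic clustering, ε ∈ (0,1/2], δ ∈ [1,∞), let (X̃,Ω̃) be an (ε/3,δ)-coreset for it with extension f. Let C̃ ∈ C_K(k,X̃,Ω̃), let S₁, S₂ be two k-tuples of sites, and let γ ∈ ℝ with γ ≥ δ. If cost_{A,K}(X̃,C̃,S₁) ≤ γ·cost_{A,K}(X̃,S₂), then cost_{A,K}(X,f(C̃),S₁) ≤ (1+ε)·γ·cost_{A,K}(X,S₂). -/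
open Finset Matrix

noncomputable section

/-- Squared anisotropic (ellipsoidal) norm `‖v‖_A² = vᵀ A v`. -/
def anormSq {d : ℕ} (A : Matrix (Fin d) (Fin d) ℝ) (v : Fin d → ℝ) : ℝ :=
  v ⬝ᵥ A.mulVec v

/-- `ξ` is a (fractional) `k`-clustering of `n` points. -/
def IsClustering {k n : ℕ} (ξ : Fin k → Fin n → ℝ) : Prop :=
  (∀ i j, 0 ≤ ξ i j) ∧ ∀ j, ∑ i, ξ i j = 1

/-- The weight `ω(C_i)` of the `i`-th cluster. -/
def clusterWeight {k n : ℕ} (ω : Fin n → ℝ) (ξ : Fin k → Fin n → ℝ) (i : Fin k) : ℝ :=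
  ∑ j, ξ i j * ω j

/-- `ξ` is a weight-constrained `k`-clustering (an element of `C_K(k,X,Ω)`). -/
def IsWCC {k n : ℕ} (κlo κhi : Fin k → ℝ) (ω : Fin n → ℝ) (ξ : Fin k → Fin n → ℝ) : Prop :=
  IsClustering ξ ∧ ∀ i, κlo i ≤ clusterWeight ω ξ i ∧ clusterWeight ω ξ i ≤ κhi i

/-- `cost_{A,K}(X,C,S)`. -/
def cost {d k n : ℕ} (A : Fin k → Matrix (Fin d) (Fin d) ℝ)
    (x : Fin n → Fin d → ℝ) (ω : Fin n → ℝ) (ξ : Fin k → Fin n → ℝ)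
    (s : Fin k → Fin d → ℝ) : ℝ :=
  ∑ i, ∑ j, ξ i j * ω j * anormSq (A i) (x j - s i)

/-- `cost_{A,K}(X,S)`: optimal constrained assignment cost for fixed sites `s`. -/
def assignCost {d k n : ℕ} (κlo κhi : Fin k → ℝ) (A : Fin k → Matrix (Fin d) (Fin d) ℝ)
    (x : Fin n → Fin d → ℝ) (ω : Fin n → ℝ) (s : Fin k → Fin d → ℝ) : ℝ :=
  sInf {c : ℝ | ∃ ξ, IsWCC κlo κhi ω ξ ∧ c = cost A x ω ξ s}

/-- `cost_{A,K}(X,C)`: infimum over site tuples. -/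
def clusterCost {d k n : ℕ} (A : Fin k → Matrix (Fin d) (Fin d) ℝ)
    (x : Fin n → Fin d → ℝ) (ω : Fin n → ℝ) (ξ : Fin k → Fin n → ℝ) : ℝ :=
  sInf {c : ℝ | ∃ s : Fin k → Fin d → ℝ, c = cost A x ω ξ s}

/-- `OPT_{A,K}(X)`. -/
def OPTc {d k n : ℕ} (κlo κhi : Fin k → ℝ) (A : Fin k → Matrix (Fin d) (Fin d) ℝ)
    (x : Fin n → Fin d → ℝ) (ω : Fin n → ℝ) : ℝ :=
  sInf {c : ℝ | ∃ ξ, IsWCC κlo κhi ω ξ ∧ c = clusterCost A x ω ξ}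

/-- Unconstrained optimum `OPT_A(X)` (over all clusterings and all site tuples). -/
def OPTu {d k n : ℕ} (A : Fin k → Matrix (Fin d) (Fin d) ℝ)
    (x : Fin n → Fin d → ℝ) (ω : Fin n → ℝ) : ℝ :=
  sInf {c : ℝ | ∃ ξ, ∃ s : Fin k → Fin d → ℝ, IsClustering ξ ∧ c = cost A x ω ξ s}

/-- `(X',Ω')` is an `(ε,δ)`-coreset for `(k,X,Ω,A,K)`, witnessed by the extension `f`
and the offsets `Δp`, `Δm`. -/
def IsCoresetWith {d k n m : ℕ} (ε δ : ℝ) (κlo κhi : Fin k → ℝ)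
    (A : Fin k → Matrix (Fin d) (Fin d) ℝ)
    (x : Fin n → Fin d → ℝ) (ω : Fin n → ℝ)
    (x' : Fin m → Fin d → ℝ) (ω' : Fin m → ℝ)
    (f : (Fin k → Fin m → ℝ) → (Fin k → Fin n → ℝ)) (Δp Δm : ℝ) : Prop :=
  0 ≤ Δp ∧ Δp ≤ δ * Δm ∧
  (∀ ξ', IsWCC κlo κhi ω' ξ' → IsWCC κlo κhi ω (f ξ')) ∧
  ∀ (s : Fin k → Fin d → ℝ) (ξ' : Fin k → Fin m → ℝ), IsWCC κlo κhi ω' ξ' →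
    (1 - ε) * cost A x ω (f ξ') s ≤ cost A x' ω' ξ' s + Δp ∧
    assignCost κlo κhi A x' ω' s + Δm ≤ (1 + ε) * assignCost κlo κhi A x ω s


theorem anormSq_nonneg {d : ℕ} {A : Matrix (Fin d) (Fin d) ℝ} (hA : A.PosSemidef)
    (v : Fin d → ℝ) : 0 ≤ anormSq A v := by
  simpa [anormSq] using hA.dotProduct_mulVec_nonneg v

theorem cost_nonneg {d k n : ℕ} {A : Fin k → Matrix (Fin d) (Fin d) ℝ}
    (hA : ∀ i, (A i).PosSemidef) (x : Fin n → Fin d → ℝ) {ω : Fin n → ℝ} (hω : ∀ j, 0 ≤ ω j)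
    {ξ : Fin k → Fin n → ℝ} (hξ : IsClustering ξ) (s : Fin k → Fin d → ℝ) :
    0 ≤ cost A x ω ξ s :=
  Finset.sum_nonneg fun i _ => Finset.sum_nonneg fun j _ =>
    mul_nonneg (mul_nonneg (hξ.1 i j) (hω j)) (anormSq_nonneg (hA i) _)

theorem assignCost_nonneg {d k n : ℕ} (κlo κhi : Fin k → ℝ)
    {A : Fin k → Matrix (Fin d) (Fin d) ℝ} (hA : ∀ i, (A i).PosSemidef)
    (x : Fin n → Fin d → ℝ) {ω : Fin n → ℝ} (hω : ∀ j, 0 ≤ ω j) (s : Fin k → Fin d → ℝ) :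
    0 ≤ assignCost κlo κhi A x ω s := by
  refine Real.sInf_nonneg ?_
  rintro c ⟨ξ, hξ, rfl⟩
  exact cost_nonneg hA x hω hξ.1 s

theorem statement3 {d k n m : ℕ} (ε δ : ℝ) (hε : 0 < ε ∧ ε ≤ 1 / 2) (hδ : 1 ≤ δ)
    (κlo κhi : Fin k → ℝ) (hκ : ∀ i, κlo i ≤ κhi i)
    (A : Fin k → Matrix (Fin d) (Fin d) ℝ) (hA : ∀ i, (A i).PosDef)
    (x : Fin n → Fin d → ℝ) (ω : Fin n → ℝ) (hω : ∀ j, 0 < ω j)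
    (x' : Fin m → Fin d → ℝ) (ω' : Fin m → ℝ) (hω' : ∀ j, 0 < ω' j)
    (hne : ∃ ξ, IsWCC κlo κhi ω ξ) (hne' : ∃ ξ', IsWCC κlo κhi ω' ξ')
    (f : (Fin k → Fin m → ℝ) → (Fin k → Fin n → ℝ)) (Δp Δm : ℝ)
    (hcs : IsCoresetWith (ε / 3) δ κlo κhi A x ω x' ω' f Δp Δm)
    (ξ' : Fin k → Fin m → ℝ) (hξ' : IsWCC κlo κhi ω' ξ')
    (S₁ S₂ : Fin k → Fin d → ℝ) (γ : ℝ) (hγ : δ ≤ γ)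
    (h : cost A x' ω' ξ' S₁ ≤ γ * assignCost κlo κhi A x' ω' S₂) :
    cost A x ω (f ξ') S₁ ≤ (1 + ε) * γ * assignCost κlo κhi A x ω S₂ := by
  obtain ⟨hΔp, hΔ, -, hf⟩ := hcs
  obtain ⟨hε0, hε1⟩ := hε
  have hupper := (hf S₁ ξ' hξ').1
  have hlower := (hf S₂ ξ' hξ').2
  have ha : 0 ≤ assignCost κlo κhi A x ω S₂ :=
    assignCost_nonneg κlo κhi (fun i => (hA i).posSemidef) x (fun j => (hω j).le) S₂
  have hδ0 : 0 < δ := by linarith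
  have hγ0 : 0 < γ := by linarith
  have hΔm : 0 ≤ Δm := nonneg_of_mul_nonneg_right (hΔp.trans hΔ) hδ0
  have hε' : 0 < 1 - ε / 3 := by linarith
  have hfactor : 1 + ε / 3 ≤ (1 - ε / 3) * (1 + ε) := by nlinarith
  refine le_of_mul_le_mul_left ?_ hε'
  calc (1 - ε / 3) * cost A x ω (f ξ') S₁
      ≤ γ * assignCost κlo κhi A x' ω' S₂ + δ * Δm := by linarith
    _ ≤ γ * (assignCost κlo κhi A x' ω' S₂ + Δm) := by
        linarith [mul_le_mul_of_nonneg_right hγ hΔm]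
    _ ≤ γ * ((1 + ε / 3) * assignCost κlo κhi A x ω S₂) := by gcongr
    _ ≤ γ * ((1 - ε / 3) * (1 + ε) * assignCost κlo κhi A x ω S₂) := by gcongr
    _ = (1 - ε / 3) * ((1 + ε) * γ * assignCost κlo κhi A x ω S₂) := by ring

end
end

section
/- Let ε₁, ε₂ ∈ (0,1/2], δ₁, δ₂ ∈ [1,∞), and set ε = ε₁ + ε₂ + ε₁ε₂ and δ = max{δ₁,δ₂}. Let (k,X,Ω,A,K) be an instance of weight-constrained anisotropic clustering, let (X̄,Ω̄) be an (ε₁,δ₁)-coreset for (k,X,Ω,A,K), and let (X̃,Ω̃) be an (ε₂,δ₂)-coreset for (k,X̄,Ω̄,A,K). Then (X̃,Ω̃) is an (ε,δ)-coreset for (k,X,Ω,A,K) (with extension f = f₁ ∘ f₂ and offsets Δ^± = Δ₁^± + Δ₂^±). -/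
open Finset Matrix

noncomputable section

theorem statement6 {d k n nb m : ℕ} (ε₁ ε₂ δ₁ δ₂ ε δ : ℝ)
    (hε₁ : 0 < ε₁ ∧ ε₁ ≤ 1 / 2) (hε₂ : 0 < ε₂ ∧ ε₂ ≤ 1 / 2)
    (hδ₁ : 1 ≤ δ₁) (hδ₂ : 1 ≤ δ₂)
    (hε : ε = ε₁ + ε₂ + ε₁ * ε₂) (hδ : δ = max δ₁ δ₂)
    (κlo κhi : Fin k → ℝ) (hκ : ∀ i, κlo i ≤ κhi i)
    (A : Fin k → Matrix (Fin d) (Fin d) ℝ) (hA : ∀ i, (A i).PosDef)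
    (x : Fin n → Fin d → ℝ) (ω : Fin n → ℝ) (hω : ∀ j, 0 < ω j)
    (xb : Fin nb → Fin d → ℝ) (ωb : Fin nb → ℝ) (hωb : ∀ j, 0 < ωb j)
    (x' : Fin m → Fin d → ℝ) (ω' : Fin m → ℝ) (hω' : ∀ j, 0 < ω' j)
    (hne : ∃ ξ, IsWCC κlo κhi ω ξ)
    (f₁ : (Fin k → Fin nb → ℝ) → (Fin k → Fin n → ℝ)) (Δp₁ Δm₁ : ℝ)
    (hcs₁ : IsCoresetWith ε₁ δ₁ κlo κhi A x ω xb ωb f₁ Δp₁ Δm₁)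
    (f₂ : (Fin k → Fin m → ℝ) → (Fin k → Fin nb → ℝ)) (Δp₂ Δm₂ : ℝ)
    (hcs₂ : IsCoresetWith ε₂ δ₂ κlo κhi A xb ωb x' ω' f₂ Δp₂ Δm₂) :
    IsCoresetWith ε δ κlo κhi A x ω x' ω' (f₁ ∘ f₂) (Δp₁ + Δp₂) (Δm₁ + Δm₂) := by
  obtain ⟨hp₁, hpm₁, hf₁, hc₁⟩ := hcs₁
  obtain ⟨hp₂, hpm₂, hf₂, hc₂⟩ := hcs₂
  have hm₁ : 0 ≤ Δm₁ := nonneg_of_mul_nonneg_right (hp₁.trans hpm₁) (by linarith)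
  have hm₂ : 0 ≤ Δm₂ := nonneg_of_mul_nonneg_right (hp₂.trans hpm₂) (by linarith)
  refine ⟨add_nonneg hp₁ hp₂, ?_, fun ξ' hξ' => hf₁ _ (hf₂ _ hξ'), fun s ξ' hξ' => ?_⟩
  · have h₁ : δ₁ * Δm₁ ≤ δ * Δm₁ :=
      mul_le_mul_of_nonneg_right (hδ ▸ le_max_left δ₁ δ₂) hm₁
    have h₂ : δ₂ * Δm₂ ≤ δ * Δm₂ :=
      mul_le_mul_of_nonneg_right (hδ ▸ le_max_right δ₁ δ₂) hm₂
    linarith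
  · obtain ⟨hl₁, hu₁⟩ := hc₁ s (f₂ ξ') (hf₂ _ hξ')
    obtain ⟨hl₂, hu₂⟩ := hc₂ s ξ' hξ'
    have hcost : 0 ≤ cost A x ω (f₁ (f₂ ξ')) s :=
      cost_nonneg (fun i => (hA i).posSemidef) x (fun j => (hω j).le)
        (hf₁ _ (hf₂ _ hξ')).1 s
    simp only [Function.comp_apply]
    subst hε
    constructor
    · have h := mul_le_mul_of_nonneg_left hl₁ (show 0 ≤ 1 - ε₂ by linarith)
      have h₁ := mul_nonneg hε₂.1.le hp₁
      have h₂ := mul_nonneg (mul_nonneg hε₁.1.le hε₂.1.le) hcost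
      linarith
    · have h := mul_le_mul_of_nonneg_left hu₁ (show 0 ≤ 1 + ε₂ by linarith)
      have h₁ := mul_nonneg hε₂.1.le hm₁
      linarith

end
end
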